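/- Let (Γ,γ) be a bipartite (d+1)-regular edge-colored graph with 2p vertices, colored by Δ_d = {0,...,d}. For each cyclic permutation ε = (ε_0,...,ε_d) of Δ_d, the quantity ρ_ε(Γ) defined by 2 - 2ρ_ε(Γ) = Σ_{j∈Z_{d+1}} g_{ε_j ε_{j+1}} + (1-d)p is a non-negative integer, where g_{ij} denotes the number of connected components of the subgraph of Γ obtained by keeping only edges colored i or j. -/

import Mathlib

open scoped Classical

namespace Cryst

/-- A `(d+1)`-regular properly edge-colored multigraph with color set `C`:
each vertex has exactly one edge of each color, encoded as a fixed-point-free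
involution for each color. -/
structure CGraph (C : Type) where
  V : Type
  finV : Finite V
  edge : V → C → V
  invol : ∀ v c, edge (edge v c) c = v
  no_loop : ∀ v c, edge v c ≠ v

attribute [instance] CGraph.finV

variable {C : Type}

/-- One-step adjacency in the subgraph keeping only the edges colored by `B`. -/
def step (G : CGraph C) (B : Set C) (v w : G.V) : Prop := ∃ c ∈ B, G.edge v c = w

/-- Reachability in the subgraph keeping only the edges colored by `B`. -/
def reaches (G : CGraph C) (B : Set C) : G.V → G.V → Prop :=
  Relation.ReflTransGen (step G B)

/-- The number `g_B` of connected components of the subgraph with colors in `B`. -/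
noncomputable def gB (G : CGraph C) (B : Set C) : ℕ := Nat.card (Quot (step G B))

def Connected (G : CGraph C) : Prop :=
  Nonempty G.V ∧ ∀ v w : G.V, reaches G Set.univ v w

def Bipartite (G : CGraph C) : Prop :=
  ∃ f : G.V → Bool, ∀ v c, f (G.edge v c) ≠ f v

/-- The (unordered) pair of cyclically consecutive colors at position `j` of the list `L`. -/
def pairSet (L : List C) (j : ℕ) : Set C :=
  {c | L[j % L.length]? = some c ∨ L[(j + 1) % L.length]? = some c}

/-- The regular genus of the subgraph of `G` colored by the entries of the list `L`,
with respect to the cyclic order given by `L` (summed over connected components):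
it is defined by `2 g - 2 ρ = Σ_j g_{L_j, L_{j+1}} + (2 - n) p`, where `n` is the
number of colors in `L`, `2p` the number of vertices and `g` the number of
connected components of the `L`-colored subgraph. -/
noncomputable def rhoL (G : CGraph C) (L : List C) : ℚ :=
  (gB G {c | c ∈ L} : ℚ) -
    ((∑ j ∈ Finset.range L.length, (gB G (pairSet L j) : ℚ)) +
      (2 - (L.length : ℚ)) * ((Nat.card G.V : ℚ) / 2)) / 2

/-- The listing of the colors determined by a permutation (a "cyclic permutation"
of the color set). -/
def permList {n : ℕ} (ε : Equiv.Perm (Fin n)) : List (Fin n) :=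
  (List.finRange n).map ε

/-- The gluing relation defining the pseudocomplex associated to a colored graph:
take one `d`-simplex per vertex of the graph and glue the facets opposite to the
vertex labelled `c` of the simplices corresponding to `c`-adjacent vertices. -/
def glueRel (G : CGraph C) [Fintype C] :
    G.V × stdSimplex ℝ C → G.V × stdSimplex ℝ C → Prop := fun p q =>
  ∃ c : C, (p.2 : C → ℝ) c = 0 ∧ q.1 = G.edge p.1 c ∧ (q.2 : C → ℝ) = (p.2 : C → ℝ)

instance (G : CGraph C) : TopologicalSpace G.V := ⊥

/-- The topological space `|K(Γ)|` underlying the pseudocomplex associated to `Γ`. -/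
abbrev Space (G : CGraph C) [Fintype C] : Type := Quot (glueRel G)

/-- The connected component ("residue") of the vertex `v` in the subgraph of `G`
obtained by deleting all `c`-colored edges, as a colored graph over the remaining colors. -/
def residue (G : CGraph C) (c : C) (v : G.V) : CGraph {c' : C // c' ≠ c} where
  V := {w : G.V // reaches G {c}ᶜ v w}
  finV := Subtype.finite
  edge := fun w c' =>
    ⟨G.edge w.1 c'.1, w.2.tail ⟨c'.1, Set.mem_compl_singleton_iff.mpr c'.2, rfl⟩⟩
  invol := fun w c' => Subtype.ext (G.invol w.1 c'.1)
  no_loop := fun w c' h => G.no_loop w.1 c'.1 (congrArg Subtype.val h)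

/-- `X` is locally Euclidean of dimension `n`. -/
def IsLocEuclidean (n : ℕ) (X : Type*) [TopologicalSpace X] : Prop :=
  ∀ x : X, ∃ (U : Set X) (W : Set (EuclideanSpace ℝ (Fin n))),
    IsOpen U ∧ IsOpen W ∧ x ∈ U ∧ Nonempty (U ≃ₜ W)

/-- `X` is a closed connected topological `n`-manifold. -/
def IsClosedMfld (n : ℕ) (X : Type*) [TopologicalSpace X] : Prop :=
  CompactSpace X ∧ ConnectedSpace X ∧ IsLocEuclidean n X

/-- `Γ` represents a singular `d`-manifold: for every color `c`, every
`ĉ`-residue of `Γ` represents a closed connected `(d-1)`-manifold. -/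
def IsSingularRep (d : ℕ) (G : CGraph (Fin (d + 1))) : Prop :=
  ∀ (c : Fin (d + 1)) (v : G.V), IsClosedMfld (d - 1) (Space (residue G c v))

/-- The `n`-sphere. -/
abbrev Sph (n : ℕ) : Type := ↥(Metric.sphere (0 : EuclideanSpace ℝ (Fin (n + 1))) 1)

/-- The closed `n`-disk. -/
abbrev Disk (n : ℕ) : Type := ↥(Metric.closedBall (0 : EuclideanSpace ℝ (Fin n)) 1)

/-- `Γ` represents the (singular `d`-manifold) `X`. -/
def Represents (d : ℕ) (G : CGraph (Fin (d + 1))) (X : Type*) [TopologicalSpace X] : Prop :=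
  Connected G ∧ IsSingularRep d G ∧ Nonempty (Space G ≃ₜ X)

/-- The generalized regular genus of the singular manifold `X`:
the infimum of the regular genera of colored graphs representing `X`. -/
noncomputable def sGenus (d : ℕ) (X : Type*) [TopologicalSpace X] : ℝ :=
  sInf {x : ℝ | ∃ (G : CGraph (Fin (d + 1))) (ε : Equiv.Perm (Fin (d + 1))),
    Represents d G X ∧ x = (rhoL G (permList ε) : ℝ)}

/-- The minimal regular genus of the graph `G` over all cyclic permutations. -/
noncomputable def rhoMin (d : ℕ) (G : CGraph (Fin (d + 1))) : ℝ :=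
  sInf {x : ℝ | ∃ ε : Equiv.Perm (Fin (d + 1)), x = (rhoL G (permList ε) : ℝ)}

/-- The Gurau degree of a `(d+1)`-colored graph: the sum of the regular genera over
all `d!/2` cyclic permutations of the colors up to inverse.  (Summing over all
`(d+1)!` permutations counts each such class `2(d+1)` times.) -/
noncomputable def omegaG (d : ℕ) (G : CGraph (Fin (d + 1))) : ℚ :=
  (∑ ε : Equiv.Perm (Fin (d + 1)), rhoL G (permList ε)) / (2 * (d + 1) : ℚ)

/-- The Gurau degree of the singular manifold `X`. -/
noncomputable def sDegree (d : ℕ) (X : Type*) [TopologicalSpace X] : ℝ :=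
  sInf {x : ℝ | ∃ G : CGraph (Fin (d + 1)), Represents d G X ∧ x = (omegaG d G : ℝ)}

/-- The Euler characteristic of the pseudocomplex `K(Γ)`: the `k`-simplices of
`K(Γ)` correspond to the residues of `Γ` over the complements of the
`(k+1)`-element sets of colors. -/
noncomputable def eulerChar (d : ℕ) (G : CGraph (Fin (d + 1))) : ℤ :=
  ∑ B ∈ (Finset.univ : Finset (Fin (d + 1))).powerset.erase Finset.univ,
    (-1 : ℤ) ^ (d - B.card) * gB G ↑B

end Cryst
namespace Cryst

theorem card_quotient_sameCycle {α : Type} [Fintype α] [DecidableEq α] (σ : Equiv.Perm α) :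
    Nat.card (Quotient (Equiv.Perm.SameCycle.setoid σ)) + σ.support.card =
      σ.cycleType.card + Fintype.card α := by
  let F : α → Equiv.Perm α ⊕ α := fun x => if σ x = x then Sum.inr x else Sum.inl (σ.cycleOf x)
  have hker : Equiv.Perm.SameCycle.setoid σ = Setoid.ker F := by
    ext x y
    change σ.SameCycle x y ↔ F x = F y
    constructor
    · intro h
      by_cases hx : σ x = x
      · have : x = y := by
          obtain ⟨i, rfl⟩ := h
          exact (Equiv.Perm.zpow_apply_eq_self_of_apply_eq_self hx i).symm
        rw [this]
      · have hy : ¬ σ y = y := fun hy => hx (h.apply_eq_self_iff.mpr hy)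
        simp [F, hx, hy, h.cycleOf_eq]
    · intro h
      by_cases hx : σ x = x <;> by_cases hy : σ y = y <;> simp [F, hx, hy] at h
      · exact h ▸ Equiv.Perm.SameCycle.refl σ x
      · exact (Equiv.Perm.sameCycle_iff_cycleOf_eq_of_mem_support
          (Equiv.Perm.mem_support.mpr hx) (Equiv.Perm.mem_support.mpr hy)).mpr h
  have hrange : Set.range F = ↑(σ.cycleFactorsFinset.disjSum σ.supportᶜ) := by
    ext z
    rcases z with c | x
    · simp only [Set.mem_range, Finset.mem_coe, Finset.inl_mem_disjSum]
      constructor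
      · rintro ⟨x, hx⟩
        by_cases h : σ x = x
        · simp [F, h] at hx
        · simp only [F, h, if_false, Sum.inl.injEq] at hx
          rw [← hx, Equiv.Perm.cycleOf_mem_cycleFactorsFinset_iff, Equiv.Perm.mem_support]
          exact h
      · intro hc
        obtain ⟨x, hx, -⟩ := (Equiv.Perm.mem_cycleFactorsFinset_iff.mp hc).1
        have hxc : x ∈ c.support := Equiv.Perm.mem_support.mpr hx
        have hxs : σ x ≠ x :=
          Equiv.Perm.mem_support.mp (Equiv.Perm.mem_cycleFactorsFinset_support_le hc hxc)
        exact ⟨x, by simp [F, hxs, ← Equiv.Perm.cycle_is_cycleOf hxc hc]⟩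
    · simp only [Set.mem_range, Finset.mem_coe, Finset.inr_mem_disjSum, Finset.mem_compl,
        Equiv.Perm.mem_support, not_not]
      constructor
      · rintro ⟨y, hy⟩
        by_cases h : σ y = y
        · simp only [F, h, if_true, Sum.inr.injEq] at hy
          exact hy ▸ h
        · simp [F, h] at hy
      · intro h
        exact ⟨x, by simp [F, h]⟩
  rw [hker, Nat.card_congr (Setoid.quotientKerEquivRange F), hrange, Nat.card_coe_set_eq,
    Set.ncard_coe_finset, Finset.card_disjSum, Finset.card_compl, Equiv.Perm.cycleType_def]
  have := Finset.card_le_univ σ.support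
  simp only [Multiset.card_map, Finset.card_val]
  omega

theorem sign_eq_neg_one_pow_card_quotient_sameCycle {α : Type} [Fintype α] [DecidableEq α]
    (σ : Equiv.Perm α) :
    Equiv.Perm.sign σ =
      (-1) ^ (Fintype.card α + Nat.card (Quotient (Equiv.Perm.SameCycle.setoid σ))) := by
  rw [Equiv.Perm.sign_of_cycleType, Equiv.Perm.sum_cycleType]
  have h := card_quotient_sameCycle σ
  refine neg_one_pow_congr ?_
  grind

/-- If the linear maps `D j` sum to zero, then the tuple `(D j)` followed by the sum map
`∏ j, range (D j) → U'` is zero; this is the dimension count of that complex. -/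
theorem finrank_add_finrank_iSup_range_le {ι U U' : Type} [Fintype ι]
    [AddCommGroup U] [Module ℚ U] [Module.Finite ℚ U]
    [AddCommGroup U'] [Module ℚ U'] [Module.Finite ℚ U']
    (D : ι → U →ₗ[ℚ] U') (hD : ∑ j, D j = 0) :
    Module.finrank ℚ U + Module.finrank ℚ ↥(⨆ j, LinearMap.range (D j)) ≤
      (∑ j, Module.finrank ℚ (LinearMap.range (D j))) +
        Module.finrank ℚ ↥(⨅ j, LinearMap.ker (D j)) := by
  classical
  let α : U →ₗ[ℚ] (∀ j, LinearMap.range (D j)) := LinearMap.pi fun j => (D j).rangeRestrict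
  let β : (∀ j, LinearMap.range (D j)) →ₗ[ℚ] U' :=
    ∑ j, (LinearMap.range (D j)).subtype ∘ₗ LinearMap.proj j
  have hα : LinearMap.ker α = ⨅ j, LinearMap.ker (D j) := by
    simp [α, LinearMap.ker_pi]
  have hαβ : LinearMap.range α ≤ LinearMap.ker β := by
    rintro _ ⟨u, rfl⟩
    have := LinearMap.congr_fun hD u
    simpa [α, β] using this
  have hβ : ⨆ j, LinearMap.range (D j) ≤ LinearMap.range β := by
    refine iSup_le fun j => ?_
    rintro _ ⟨u, rfl⟩
    refine ⟨Pi.single j ((D j).rangeRestrict u), ?_⟩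
    simp only [β, LinearMap.sum_apply, LinearMap.comp_apply, LinearMap.proj_apply]
    rw [Finset.sum_eq_single j]
    · simp
    · intro i _ hi
      simp [Pi.single_eq_of_ne hi]
    · simp
  have h1 := LinearMap.finrank_range_add_finrank_ker α
  have h2 := LinearMap.finrank_range_add_finrank_ker β
  have h3 := Submodule.finrank_mono hαβ
  have h4 := Submodule.finrank_mono hβ
  rw [Module.finrank_pi_fintype] at h2
  rw [hα] at h1
  omega

/-- The edges of a given color of a bipartite graph, as a bijection between the two classes. -/
def edgeEquiv (G : CGraph C) (f : G.V → Bool) (hf : ∀ v c, f (G.edge v c) ≠ f v) (c : C) :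
    {v // f v = true} ≃ {v // f v = false} where
  toFun v := ⟨G.edge v.1 c, by have := hf v.1 c; rw [v.2] at this; simpa using this⟩
  invFun v := ⟨G.edge v.1 c, by have := hf v.1 c; rw [v.2] at this; simpa using this⟩
  left_inv v := Subtype.ext (G.invol v.1 c)
  right_inv v := Subtype.ext (G.invol v.1 c)

theorem gB_pair_eq_card_quotient_sameCycle (G : CGraph C) (f : G.V → Bool)
    (hf : ∀ v c, f (G.edge v c) ≠ f v) (i j : C) :
    gB G {i, j} = Nat.card (Quotient (Equiv.Perm.SameCycle.setoid
      ((edgeEquiv G f hf i).trans (edgeEquiv G f hf j).symm))) := by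
  set σ : Equiv.Perm {v // f v = true} :=
    (edgeEquiv G f hf i).trans (edgeEquiv G f hf j).symm with hσ
  have hmk (v : G.V) (c : C) (hc : c ∈ ({i, j} : Set C)) :
      Quot.mk (step G {i, j}) v = Quot.mk (step G {i, j}) (G.edge v c) :=
    Quot.sound ⟨c, hc, rfl⟩
  have hpow (x : {v // f v = true}) (n : ℕ) :
      Quot.mk (step G {i, j}) x.1 = Quot.mk (step G {i, j}) ((σ ^ n) x).1 := by
    induction n with
    | zero => rfl
    | succ n ih =>
      rw [ih, pow_succ', Equiv.Perm.mul_apply, hmk _ i (by simp), hmk _ j (by simp)]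
      rfl
  let toQuot : Quotient (Equiv.Perm.SameCycle.setoid σ) → Quot (step G {i, j}) :=
    Quotient.lift (fun w => Quot.mk _ w.1) (by
      intro x y h
      obtain ⟨n, -, rfl⟩ := Equiv.Perm.SameCycle.exists_pow_eq' (h : σ.SameCycle x y)
      exact hpow x n)
  have hstep (x : {v // f v = true}) :
      (Quotient.mk (Equiv.Perm.SameCycle.setoid σ) (σ x)) = Quotient.mk _ x :=
    Quotient.sound (show σ.SameCycle (σ x) x from Equiv.Perm.sameCycle_apply_left.mpr (.refl _ _))
  let toQuotient : G.V → Quotient (Equiv.Perm.SameCycle.setoid σ) := fun v =>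
    if h : f v = true then Quotient.mk _ ⟨v, h⟩
    else Quotient.mk _ ((edgeEquiv G f hf j).symm ⟨v, by simpa using h⟩)
  have hinv_true (v : G.V) (hv : f v = true) (c : C) (hc : c ∈ ({i, j} : Set C)) :
      toQuotient v = toQuotient (G.edge v c) := by
    have hv' : ¬ f (G.edge v c) = true := by rw [← hv]; exact hf v c
    simp only [toQuotient, hv, hv', dif_pos]
    rcases hc with rfl | rfl
    · exact (hstep ⟨v, hv⟩).symm
    · congr 1
      exact Subtype.ext (G.invol v _).symm
  have hinv (v w : G.V) (h : step G {i, j} v w) : toQuotient v = toQuotient w := by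
    obtain ⟨c, hc, rfl⟩ := h
    by_cases hv : f v = true
    · exact hinv_true v hv c hc
    · have h1 := hf v c
      have := hinv_true (G.edge v c) (by grind) c hc
      rw [this, G.invol]
  refine Nat.card_congr ⟨Quot.lift toQuotient hinv, toQuot, ?_, ?_⟩
  · rintro ⟨v⟩
    change toQuot (toQuotient v) = _
    by_cases hv : f v = true
    · simp only [toQuotient, hv, dif_pos]
      rfl
    · simp only [toQuotient, hv]
      exact (hmk v j (by simp)).symm
  · rintro ⟨x⟩
    change toQuotient x.1 = _
    simp only [toQuotient, x.2, dif_pos]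
    rfl

theorem eq_of_forall_edge_eq {G : CGraph C} (hG : Connected G) {f : G.V → Bool}
    (hf : ∀ v c, f (G.edge v c) ≠ f v) (b : Bool) (u : G.V → ℚ)
    (hu : ∀ v, f v ≠ b → ∀ k k', u (G.edge v k) = u (G.edge v k'))
    {x y : G.V} (hx : f x = b) (hy : f y = b) : u x = u y := by
  have key : ∀ v, reaches G Set.univ x v →
      (f v = b → u v = u x) ∧ (f v ≠ b → ∀ k, u (G.edge v k) = u x) := by
    intro v h
    induction h with
    | refl => exact ⟨fun _ => rfl, fun h => absurd hx h⟩
    | @tail v w _ h ih =>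
      obtain ⟨c, -, rfl⟩ := h
      have h1 := hf v c
      refine ⟨fun hw => ih.2 (by grind) c, fun hw k => ?_⟩
      rw [hu _ hw k c, G.invol]
      exact ih.1 (Bool.not_inj ((Bool.eq_not.mpr h1).symm.trans (Bool.eq_not.mpr hw)))
  exact ((key y (hG.2 x y)).1 hy).symm

section Boundary

variable (G : CGraph C) (f : G.V → Bool) (hf : ∀ v c, f (G.edge v c) ≠ f v)

/-- The difference of the transfer maps along the edges of colors `j` and `i`. -/
noncomputable def edgeDiff (i j : C) :
    ({v // f v = true} → ℚ) →ₗ[ℚ] ({v // f v = false} → ℚ) :=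
  LinearMap.funLeft ℚ ℚ (edgeEquiv G f hf j).symm -
    LinearMap.funLeft ℚ ℚ (edgeEquiv G f hf i).symm

theorem edgeDiff_apply (i j : C) (u : {v // f v = true} → ℚ) (b : {v // f v = false}) :
    edgeDiff G f hf i j u b =
      u ((edgeEquiv G f hf j).symm b) - u ((edgeEquiv G f hf i).symm b) := rfl

theorem edgeDiff_single (i j : C) (w : {v // f v = true}) :
    edgeDiff G f hf i j (Pi.single w 1) =
      Pi.single (edgeEquiv G f hf j w) 1 - Pi.single (edgeEquiv G f hf i w) 1 := by
  ext b
  simp [edgeDiff_apply, Pi.single_apply, Equiv.symm_apply_eq]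

theorem finrank_range_edgeDiff_add_gB_le (i j : C) :
    Module.finrank ℚ (LinearMap.range (edgeDiff G f hf i j)) + gB G {i, j} ≤
      Nat.card {v // f v = true} := by
  have : Fintype G.V := Fintype.ofFinite _
  have : Fintype (Quot (step G {i, j})) := Fintype.ofFinite _
  let q : {v // f v = true} → Quot (step G {i, j}) := fun w => Quot.mk _ w.1
  have hq : Function.Surjective q := by
    rintro ⟨v⟩
    by_cases hv : f v = true
    · exact ⟨⟨v, hv⟩, rfl⟩
    · refine ⟨⟨G.edge v i, by have := hf v i; grind⟩, (Quot.sound ⟨i, by simp, rfl⟩).symm⟩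
  have hle : LinearMap.range (LinearMap.funLeft ℚ ℚ q) ≤
      LinearMap.ker (edgeDiff G f hf i j) := by
    rintro _ ⟨u, rfl⟩
    rw [LinearMap.mem_ker]
    ext b
    have hi : Quot.mk (step G {i, j}) b.1 = q ((edgeEquiv G f hf i).symm b) :=
      Quot.sound ⟨i, by simp, rfl⟩
    have hj : Quot.mk (step G {i, j}) b.1 = q ((edgeEquiv G f hf j).symm b) :=
      Quot.sound ⟨j, by simp, rfl⟩
    simp [edgeDiff_apply, LinearMap.funLeft_apply, ← hi, ← hj]
  have h1 := Submodule.finrank_mono hle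
  rw [LinearMap.finrank_range_of_inj (LinearMap.funLeft_injective_of_surjective ℚ ℚ q hq),
    Module.finrank_fintype_fun_eq_card] at h1
  have h2 := LinearMap.finrank_range_add_finrank_ker (edgeDiff G f hf i j)
  rw [Module.finrank_fintype_fun_eq_card] at h2
  rw [gB, Nat.card_eq_fintype_card, Nat.card_eq_fintype_card]
  omega

variable {G f} (c : ℕ → C) (n : ℕ)

theorem eq_of_forall_succ_eq {β : Type} {c : ℕ → C} {n : ℕ}
    (hc : ∀ k, ∃ j < n, c j = k) (g : C → β)
    (hg : ∀ j < n, g (c (j + 1)) = g (c j)) (k k' : C) : g k = g k' := by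
  have h : ∀ j < n, g (c j) = g (c 0) := by
    intro j
    induction j with
    | zero => exact fun _ => rfl
    | succ j ih => exact fun hj => (hg j (by omega)).trans (ih (by omega))
  obtain ⟨j, hj, rfl⟩ := hc k
  obtain ⟨j', hj', rfl⟩ := hc k'
  rw [h j hj, h j' hj']

theorem finrank_iInf_ker_edgeDiff_le (hG : Connected G) (hc : ∀ k, ∃ j < n, c j = k) :
    Module.finrank ℚ
      ↥(⨅ j : Fin n, LinearMap.ker (edgeDiff G f hf (c j) (c (j + 1)))) ≤ 1 := by
  have hle : (⨅ j : Fin n, LinearMap.ker (edgeDiff G f hf (c j) (c (j + 1)))) ≤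
      Submodule.span ℚ {fun _ => 1} := by
    intro u hu
    simp only [Submodule.mem_iInf, LinearMap.mem_ker] at hu
    have hconst : ∀ x y, u x = u y := by
      intro x y
      let u' : G.V → ℚ := fun v => if h : f v = true then u ⟨v, h⟩ else 0
      have key : u' x.1 = u' y.1 := by
        refine eq_of_forall_edge_eq hG hf true u' (fun v hv k k' => ?_) x.2 y.2
        refine eq_of_forall_succ_eq hc (fun k => u' (G.edge v k)) (fun j hj => ?_) k k'
        have h1 : f (G.edge v (c (j + 1))) = true := by have := hf v (c (j + 1)); grind
        have h2 : f (G.edge v (c j)) = true := by have := hf v (c j); grind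
        have := congrFun (hu ⟨j, hj⟩) ⟨v, by simpa using hv⟩
        rw [edgeDiff_apply, Pi.zero_apply, sub_eq_zero] at this
        simp only [u', h1, h2, dif_pos]
        exact this
      simpa [u', x.2, y.2] using key
    rw [Submodule.mem_span_singleton]
    by_cases hW : Nonempty {v // f v = true}
    · obtain ⟨w⟩ := hW
      exact ⟨u w, funext fun x => by simp [hconst x w]⟩
    · exact ⟨0, funext fun x => absurd ⟨x⟩ hW⟩
  refine (Submodule.finrank_mono hle).trans ((finrank_span_le_card _).trans ?_)
  simp

theorem card_le_finrank_iSup_range_edgeDiff_add_one (hG : Connected G)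
    (hc : ∀ k, ∃ j < n, c j = k) :
    Nat.card {v // f v = false} ≤ Module.finrank ℚ
      ↥(⨆ j : Fin n, LinearMap.range (edgeDiff G f hf (c j) (c (j + 1)))) + 1 := by
  have : Fintype G.V := Fintype.ofFinite _
  set S := ⨆ j : Fin n, LinearMap.range (edgeDiff G f hf (c j) (c (j + 1))) with hS
  have hle : S.dualAnnihilator ≤
      Submodule.span ℚ {∑ b : {v // f v = false}, LinearMap.proj b} := by
    intro φ hφ
    rw [Submodule.mem_dualAnnihilator] at hφ
    let g : {v // f v = false} → ℚ := fun b => φ (Pi.single b 1)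
    have hconst : ∀ x y, g x = g y := by
      intro x y
      let u' : G.V → ℚ := fun v => if h : f v = false then g ⟨v, h⟩ else 0
      have key : u' x.1 = u' y.1 := by
        refine eq_of_forall_edge_eq hG hf false u' (fun v hv k k' => ?_) x.2 y.2
        refine eq_of_forall_succ_eq hc (fun k => u' (G.edge v k)) (fun j hj => ?_) k k'
        have h1 : f (G.edge v (c (j + 1))) = false := by have := hf v (c (j + 1)); grind
        have h2 : f (G.edge v (c j)) = false := by have := hf v (c j); grind
        have := hφ (edgeDiff G f hf (c j) (c (j + 1)) (Pi.single ⟨v, by simpa using hv⟩ 1))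
          (hS ▸ Submodule.mem_iSup_of_mem (⟨j, hj⟩ : Fin n) (LinearMap.mem_range_self _ _))
        rw [edgeDiff_single, map_sub, sub_eq_zero] at this
        simp only [u', h1, h2, dif_pos]
        exact this
      simpa [u', x.2, y.2] using key
    rw [Submodule.mem_span_singleton]
    by_cases hB : Nonempty {v // f v = false}
    · obtain ⟨b⟩ := hB
      refine ⟨g b, LinearMap.pi_ext' fun x => LinearMap.ext_ring ?_⟩
      simp only [LinearMap.comp_apply, LinearMap.smul_apply, LinearMap.sum_apply,
        LinearMap.proj_apply, LinearMap.single_apply]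
      simpa using hconst b x
    · exact ⟨0, LinearMap.pi_ext' fun x => absurd ⟨x⟩ hB⟩
  have h1 : Module.finrank ℚ S.dualAnnihilator ≤ 1 := by
    refine (Submodule.finrank_mono hle).trans ((finrank_span_le_card _).trans ?_)
    simp
  have h2 := Subspace.finrank_add_finrank_dualAnnihilator_eq S
  rw [Module.finrank_fintype_fun_eq_card] at h2
  rw [Nat.card_eq_fintype_card]
  omega

end Boundary

theorem two_mul_card_add_sum_gB_le {G : CGraph C} {f : G.V → Bool}
    (hf : ∀ v c, f (G.edge v c) ≠ f v) (c : ℕ → C) (n : ℕ)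
    (hG : Connected G) (hc : ∀ k, ∃ j < n, c j = k)
    (hcn : c n = c 0) :
    2 * Nat.card {v // f v = true} + ∑ j ∈ Finset.range n, gB G {c j, c (j + 1)} ≤
      n * Nat.card {v // f v = true} + 2 := by
  have : Fintype G.V := Fintype.ofFinite _
  have hsum : ∑ j : Fin n, edgeDiff G f hf (c j) (c (j + 1)) = 0 := by
    rw [Fin.sum_univ_eq_sum_range (fun j => edgeDiff G f hf (c j) (c (j + 1)))]
    unfold edgeDiff
    rw [Finset.sum_range_sub (fun j => LinearMap.funLeft ℚ ℚ (edgeEquiv G f hf (c j)).symm),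
      hcn, sub_self]
  have h1 := finrank_add_finrank_iSup_range_le _ hsum
  have h2 := finrank_iInf_ker_edgeDiff_le hf c n hG hc
  have h3 := card_le_finrank_iSup_range_edgeDiff_add_one hf c n hG hc
  have h4 : ∑ j : Fin n, (Module.finrank ℚ
      (LinearMap.range (edgeDiff G f hf (c j) (c (j + 1)))) + gB G {c j, c (j + 1)}) ≤
      ∑ _j : Fin n, Nat.card {v // f v = true} :=
    Finset.sum_le_sum fun j _ => finrank_range_edgeDiff_add_gB_le G f hf _ _
  rw [Finset.sum_add_distrib, Fin.sum_univ_eq_sum_range (fun j => gB G {c j, c (j + 1)})] at h4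
  simp only [Finset.sum_const, Finset.card_univ, Fintype.card_fin, smul_eq_mul] at h4
  rw [Module.finrank_fintype_fun_eq_card, ← Nat.card_eq_fintype_card] at h1
  rw [← Nat.card_congr (edgeEquiv G f hf (c 0))] at h3
  omega

theorem even_mul_card_add_sum_gB {G : CGraph C} {f : G.V → Bool}
    (hf : ∀ v c, f (G.edge v c) ≠ f v) (c : ℕ → C) (n : ℕ) (hcn : c n = c 0) :
    Even (n * Nat.card {v // f v = true} +
      ∑ j ∈ Finset.range n, gB G {c j, c (j + 1)}) := by
  have : Fintype G.V := Fintype.ofFinite _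
  let s : ℕ → ℤˣ := fun j =>
    Equiv.Perm.sign ((edgeEquiv G f hf (c j)).trans (edgeEquiv G f hf (c 0)).symm)
  have hs (j : ℕ) : (-1) ^ (Nat.card {v // f v = true} + gB G {c j, c (j + 1)}) =
      s j * s (j + 1) := by
    rw [gB_pair_eq_card_quotient_sameCycle G f hf, Nat.card_eq_fintype_card (α := {v // _}),
      ← sign_eq_neg_one_pow_card_quotient_sameCycle, mul_comm]
    simp only [s]
    rw [← Equiv.Perm.sign_inv ((edgeEquiv G f hf (c (j + 1))).trans _), ← Equiv.Perm.sign_mul]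
    congr 1
    ext x
    simp [Equiv.Perm.mul_apply, Equiv.Perm.inv_def]
  have hprod (m : ℕ) : ∏ j ∈ Finset.range m, (s j * s (j + 1)) = s 0 * s m := by
    induction m with
    | zero => simp
    | succ m ih =>
      rw [Finset.prod_range_succ, ih, mul_assoc, ← mul_assoc (s m), Int.units_mul_self, one_mul]
  have h := hprod n
  have hsn : s n = s 0 := by simp only [s, hcn]
  rw [hsn, Int.units_mul_self, ← Finset.prod_congr rfl fun j _ => hs j,
    Finset.prod_pow_eq_pow_sum, Finset.sum_add_distrib] at h
  simp only [Finset.sum_const, Finset.card_range, smul_eq_mul] at h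
  exact (neg_one_pow_eq_one_iff_even (by decide)).mp h

theorem card_eq_two_mul_card_class [Nonempty C] {G : CGraph C} {f : G.V → Bool}
    (hf : ∀ v c, f (G.edge v c) ≠ f v) :
    Nat.card G.V = 2 * Nat.card {v // f v = true} := by
  have h : Nat.card {v // ¬ f v = true} = Nat.card {v // f v = true} := by
    rw [Nat.card_congr (edgeEquiv G f hf (Classical.arbitrary C))]
    simp
  rw [← Nat.card_congr (Equiv.sumCompl fun v : G.V => f v = true), Nat.card_sum, h]
  ring

theorem gB_univ_eq_one {G : CGraph C} (hG : Connected G) : gB G Set.univ = 1 := by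
  rw [gB, Nat.card_eq_one_iff_unique]
  obtain ⟨⟨v⟩, h⟩ := hG
  refine ⟨⟨?_⟩, ⟨Quot.mk _ v⟩⟩
  rintro ⟨x⟩ ⟨y⟩
  induction h x y with
  | refl => rfl
  | tail _ h ih => exact ih.trans (Quot.sound h)

theorem pairSet_permList {d : ℕ} (ε : Equiv.Perm (Fin (d + 1))) (j : ℕ) :
    pairSet (permList ε) j = {ε (Fin.ofNat (d + 1) j), ε (Fin.ofNat (d + 1) (j + 1))} := by
  have hget (m : ℕ) : (permList ε)[m % (permList ε).length]? = some (ε (Fin.ofNat (d + 1) m)) := by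
    have hlt : m % (d + 1) < d + 1 := Nat.mod_lt _ (by omega)
    simp [permList, hlt, Fin.ofNat]
  ext x
  simp only [pairSet, hget, Set.mem_ofPred_eq, Option.some.injEq, Set.mem_insert_iff,
    Set.mem_singleton_iff, eq_comm]

/-- for a connected bipartite `(d+1)`-colored graph and any cyclic
permutation `ε` of the colors, the regular genus `ρ_ε(Γ)` defined by
`2 - 2ρ_ε(Γ) = Σ_j g_{ε_j ε_{j+1}} + (1-d)p` is a non-negative integer. -/
theorem regular_genus_nonneg_integer (d : ℕ) (hd : 2 ≤ d)
    (G : CGraph (Fin (d + 1))) (hG : Connected G) (hb : Bipartite G)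
    (ε : Equiv.Perm (Fin (d + 1))) :
    ∃ n : ℕ, rhoL G (permList ε) = (n : ℚ) := by
  obtain ⟨f, hf⟩ := hb
  let c : ℕ → Fin (d + 1) := fun j => ε (Fin.ofNat (d + 1) j)
  have hc : ∀ k, ∃ j < d + 1, c j = k := fun k =>
    ⟨(ε.symm k).1, (ε.symm k).2, by simp [c]⟩
  have hcn : c (d + 1) = c 0 := by simp [c, Fin.ofNat]
  have hle := two_mul_card_add_sum_gB_le hf c (d + 1) hG hc hcn
  have heven := even_mul_card_add_sum_gB hf c (d + 1) hcn
  have hcard := card_eq_two_mul_card_class hf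
  have hlen : (permList ε).length = d + 1 := by simp [permList]
  have huniv : {x | x ∈ permList ε} = Set.univ := by
    ext x
    simpa [permList] using ε.surjective x
  set p := Nat.card {v // f v = true}
  have hpair (j : ℕ) : pairSet (permList ε) j = {c j, c (j + 1)} := pairSet_permList ε j
  simp only [rhoL, hlen, huniv, gB_univ_eq_one hG, hpair, hcard, ← Nat.cast_sum]
  set S := ∑ j ∈ Finset.range (d + 1), gB G {c j, c (j + 1)}
  obtain ⟨m, hm⟩ : ∃ m, (d + 1) * p + 2 = 2 * p + S + 2 * m := by
    obtain ⟨r, hr⟩ := heven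
    exact ⟨((d + 1) * p + 2 - (2 * p + S)) / 2, by omega⟩
  refine ⟨m, ?_⟩
  have hm' : ((d : ℚ) + 1) * p + 2 = 2 * p + S + 2 * m := by exact_mod_cast hm
  push_cast
  linarith

end Cryst
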